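/- For every natural number D ≥ 1 there is a constant C > 0 such that the following holds. Let Z be a finite connected simple graph with at least one edge and maximum degree at most D, let m ≥ 1 be a natural number, and let Z⁽ᵐ⁾ be the graph obtained from Z by replacing every edge by a path consisting of m edges through m − 1 new vertices (the m-fold subdivision of Z). Then (1/C)·λ1(Z)/m² ≤ λ1(Z⁽ᵐ⁾) ≤ C·λ1(Z)/m². -/

import Mathlib

noncomputable section

open scoped Classical in
/-- The Rayleigh quotient `R_X(f) = (½ ∑_{x∼y} (f x − f y)²) / (∑_x f x²)`,
where the numerator sum runs over ordered pairs of adjacent vertices. -/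
def rayleighQuot {V : Type} [Fintype V] (G : SimpleGraph V) (f : V → ℝ) : ℝ :=
  (2⁻¹ * ∑ x : V, ∑ y : V, if G.Adj x y then (f x - f y) ^ 2 else 0) / ∑ x : V, (f x) ^ 2

/-- The spectral gap `λ₁(X)`, i.e. the smallest Rayleigh quotient of a nonzero
function of mean zero; for finite connected graphs this is the second-smallest
eigenvalue of the combinatorial Laplacian. -/
def spectralGap {V : Type} [Fintype V] (G : SimpleGraph V) : ℝ :=
  sInf {r : ℝ | ∃ f : V → ℝ, f ≠ 0 ∧ (∑ x : V, f x) = 0 ∧ rayleighQuot G f = r}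

/-- `IsMSubdivision Z Y m ι P` says that `Y` is (isomorphic to) the `m`-fold subdivision
`Z⁽ᵐ⁾` of `Z`: `ι` embeds the vertices of `Z` into `Y`, and for each edge `u ∼ v` of `Z`,
`P u v 0, P u v 1, …, P u v m` is the replacing path of `m` edges from `ι u` to `ι v`,
whose `m − 1` interior vertices are new, pairwise distinct, and used by no other edge;
every vertex of `Y` arises this way and these paths carry all the adjacencies of `Y`. -/
structure IsMSubdivision {Vz Vy : Type} (Z : SimpleGraph Vz) (Y : SimpleGraph Vy)
    (m : ℕ) (ι : Vz → Vy) (P : Vz → Vz → ℕ → Vy) : Prop where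
  inj : Function.Injective ι
  start : ∀ ⦃u v⦄, Z.Adj u v → P u v 0 = ι u
  finish : ∀ ⦃u v⦄, Z.Adj u v → P u v m = ι v
  rev : ∀ ⦃u v⦄, Z.Adj u v → ∀ i ≤ m, P v u (m - i) = P u v i
  inj_on : ∀ ⦃u v⦄, Z.Adj u v → ∀ i ≤ m, ∀ j ≤ m, P u v i = P u v j → i = j
  interior_not_vertex : ∀ ⦃u v⦄, Z.Adj u v → ∀ i, 0 < i → i < m → ∀ x, P u v i ≠ ι x
  interior_disjoint : ∀ ⦃u v u' v'⦄, Z.Adj u v → Z.Adj u' v' →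
    ∀ i j, 0 < i → i < m → 0 < j → j < m → P u v i = P u' v' j →
      (u = u' ∧ v = v' ∧ i = j) ∨ (u = v' ∧ v = u' ∧ i = m - j)
  cover : ∀ y : Vy, (∃ x, y = ι x) ∨ ∃ u v i, Z.Adj u v ∧ 0 < i ∧ i < m ∧ y = P u v i
  adj_iff : ∀ a b : Vy, Y.Adj a b ↔ ∃ u v i, Z.Adj u v ∧ i < m ∧
    ((a = P u v i ∧ b = P u v (i + 1)) ∨ (b = P u v i ∧ a = P u v (i + 1)))

/-- The ordered pairs of adjacent vertices. -/
def adjPairs {V : Type} [Fintype V] (G : SimpleGraph V) : Finset (V × V) :=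
  open scoped Classical in Finset.univ.filter fun p => G.Adj p.1 p.2

@[simp] lemma mem_adjPairs {V : Type} [Fintype V] {G : SimpleGraph V} {p : V × V} :
    p ∈ adjPairs G ↔ G.Adj p.1 p.2 := by
  simp [adjPairs]

/-- The Dirichlet energy, summed over ordered pairs of adjacent vertices. -/
def dirichletEnergy {V : Type} [Fintype V] (G : SimpleGraph V) (f : V → ℝ) : ℝ :=
  ∑ p ∈ adjPairs G, (f p.1 - f p.2) ^ 2

lemma rayleighQuot_eq {V : Type} [Fintype V] (G : SimpleGraph V) (f : V → ℝ) :
    rayleighQuot G f = (2⁻¹ * dirichletEnergy G f) / ∑ x, f x ^ 2 := by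
  simp only [rayleighQuot, dirichletEnergy, adjPairs, Finset.sum_filter, ← Finset.univ_product_univ,
    Finset.sum_product]

lemma dirichletEnergy_nonneg {V : Type} [Fintype V] (G : SimpleGraph V) (f : V → ℝ) :
    0 ≤ dirichletEnergy G f :=
  Finset.sum_nonneg fun _ _ => sq_nonneg _

lemma dirichletEnergy_sub_const {V : Type} [Fintype V] (G : SimpleGraph V) (f : V → ℝ) (c : ℝ) :
    dirichletEnergy G (fun x => f x - c) = dirichletEnergy G f := by
  simp [dirichletEnergy]

lemma sum_sq_pos {V : Type} [Fintype V] {f : V → ℝ} (hf : f ≠ 0) : 0 < ∑ x, f x ^ 2 := by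
  obtain ⟨x, hx⟩ := Function.ne_iff.mp hf
  exact Finset.sum_pos' (fun _ _ => sq_nonneg _) ⟨x, Finset.mem_univ _, sq_pos_of_ne_zero hx⟩

lemma rayleighQuot_nonneg {V : Type} [Fintype V] (G : SimpleGraph V) (f : V → ℝ) :
    0 ≤ rayleighQuot G f := by
  rw [rayleighQuot_eq]
  have := dirichletEnergy_nonneg G f
  positivity

lemma spectralGap_nonneg {V : Type} [Fintype V] (G : SimpleGraph V) : 0 ≤ spectralGap G := by
  apply Real.sInf_nonneg
  rintro _ ⟨f, -, -, rfl⟩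
  exact rayleighQuot_nonneg G f

lemma spectralGap_le_rayleighQuot {V : Type} [Fintype V] (G : SimpleGraph V) {f : V → ℝ}
    (hf : f ≠ 0) (h0 : ∑ x, f x = 0) : spectralGap G ≤ rayleighQuot G f := by
  refine csInf_le ⟨0, ?_⟩ ⟨f, hf, h0, rfl⟩
  rintro _ ⟨f, -, -, rfl⟩
  exact rayleighQuot_nonneg G f

lemma spectralGap_mul_le {V : Type} [Fintype V] (G : SimpleGraph V) {f : V → ℝ}
    (h0 : ∑ x, f x = 0) : spectralGap G * ∑ x, f x ^ 2 ≤ 2⁻¹ * dirichletEnergy G f := by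
  by_cases hf : f = 0
  · have := dirichletEnergy_nonneg G f
    subst hf
    simpa using this
  · have h := spectralGap_le_rayleighQuot G hf h0
    rwa [rayleighQuot_eq, le_div_iff₀ (sum_sq_pos hf)] at h

lemma exists_ne_zero_sum_eq_zero {V : Type} [Fintype V] [Nontrivial V] :
    ∃ f : V → ℝ, f ≠ 0 ∧ ∑ x, f x = 0 := by
  classical
  obtain ⟨a, b, hab⟩ := exists_pair_ne V
  refine ⟨fun x => (if x = a then 1 else 0) - (if x = b then 1 else 0), fun h => ?_, by simp⟩
  simpa [hab] using congrFun h a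

lemma le_spectralGap {V : Type} [Fintype V] [Nontrivial V] {G : SimpleGraph V} {c : ℝ}
    (h : ∀ f : V → ℝ, f ≠ 0 → ∑ x, f x = 0 → c * ∑ x, f x ^ 2 ≤ 2⁻¹ * dirichletEnergy G f) :
    c ≤ spectralGap G := by
  obtain ⟨f, hf, h0⟩ := exists_ne_zero_sum_eq_zero (V := V)
  refine le_csInf ⟨_, f, hf, h0, rfl⟩ ?_
  rintro _ ⟨g, hg, hg0, rfl⟩
  rw [rayleighQuot_eq, le_div_iff₀ (sum_sq_pos hg)]
  exact h g hg hg0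

lemma sum_sub_mean {V : Type} [Fintype V] [Nonempty V] (f : V → ℝ) :
    ∑ x, (f x - (∑ y, f y) / Fintype.card V) = 0 := by
  have : (Fintype.card V : ℝ) ≠ 0 := by exact_mod_cast Fintype.card_ne_zero
  rw [Finset.sum_sub_distrib, Finset.sum_const, Finset.card_univ, nsmul_eq_mul]
  field_simp
  ring

lemma sum_sq_le_sum_sub_const_sq {V : Type} [Fintype V] {f : V → ℝ} (h0 : ∑ x, f x = 0) (c : ℝ) :
    ∑ x, f x ^ 2 ≤ ∑ x, (f x - c) ^ 2 := by
  have : ∑ x, (f x - c) ^ 2 = ∑ x, f x ^ 2 - 2 * c * ∑ x, f x + Fintype.card V * c ^ 2 := by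
    simp only [sub_sq, Finset.sum_add_distrib, Finset.sum_sub_distrib, Finset.mul_sum,
      Finset.sum_const, Finset.card_univ, nsmul_eq_mul]
    congr 2
    exact Finset.sum_congr rfl fun x _ => by ring
  rw [this, h0]
  have : 0 ≤ (Fintype.card V : ℝ) * c ^ 2 := by positivity
  linarith

lemma sum_comp_le_mul_sum {α β : Type*} [Fintype β] [DecidableEq β] {T : Finset α} {p : α → β}
    {S : Finset β} {g : β → ℝ} (hg : ∀ y, 0 ≤ g y) {k : ℕ} (hS : ∀ t ∈ T, p t ∈ S)
    (hk : ∀ y, (T.filter fun t => p t = y).card ≤ k) :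
    ∑ t ∈ T, g (p t) ≤ k * ∑ y ∈ S, g y := by
  rw [← Finset.sum_fiberwise_of_maps_to' hS, Finset.mul_sum]
  refine Finset.sum_le_sum fun y _ => ?_
  rw [Finset.sum_const, nsmul_eq_mul]
  exact mul_le_mul_of_nonneg_right (by exact_mod_cast hk y) (hg y)

lemma sum_le_sum_comp {α β : Type*} [DecidableEq β] {T : Finset α} {p : α → β}
    {S : Finset β} {g : β → ℝ} (hg : ∀ y, 0 ≤ g y) (hS : ∀ y ∈ S, ∃ t ∈ T, p t = y) :
    ∑ y ∈ S, g y ≤ ∑ t ∈ T, g (p t) := by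
  rcases S.eq_empty_or_nonempty with rfl | ⟨y₀, hy₀⟩
  · simpa using Finset.sum_nonneg fun t _ => hg (p t)
  have : Nonempty α := ⟨(hS y₀ hy₀).choose⟩
  choose! q hqT hq using hS
  classical
  have hinj : Set.InjOn q S := fun a ha b hb h => by rw [← hq a ha, ← hq b hb, h]
  calc ∑ y ∈ S, g y = ∑ t ∈ S.image q, g (p t) := by
        rw [Finset.sum_image hinj]
        exact Finset.sum_congr rfl fun y hy => by rw [hq y hy]
    _ ≤ ∑ t ∈ T, g (p t) := by
        refine Finset.sum_le_sum_of_subset_of_nonneg ?_ fun _ _ _ => hg _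
        intro t ht
        obtain ⟨y, hy, rfl⟩ := Finset.mem_image.mp ht
        exact hqT y hy

lemma card_adjPairs_fst_eq {V : Type} [Fintype V] [DecidableEq V] (G : SimpleGraph V) (x : V) :
    ((adjPairs G).filter fun p => p.1 = x).card ≤ (G.neighborSet x).ncard := by
  rw [← Finset.card_image_of_injOn (f := Prod.snd), ← Set.ncard_coe_finset]
  · refine Set.ncard_le_ncard ?_ (Set.toFinite _)
    intro y hy
    simp only [Finset.coe_image, Finset.coe_filter, mem_adjPairs] at hy
    obtain ⟨⟨a, b⟩, ⟨h, rfl⟩, rfl⟩ := hy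
    exact h
  · rintro ⟨a, b⟩ h ⟨a', b'⟩ h' hb
    simp only [Finset.coe_filter, Set.mem_ofPred_eq] at h h' hb
    rw [h.2, h'.2, hb]

lemma sum_adjPairs_fst_le {V : Type} [Fintype V] {G : SimpleGraph V} {D : ℕ}
    (hD : ∀ v, (G.neighborSet v).ncard ≤ D) {g : V → ℝ} (hg : ∀ x, 0 ≤ g x) :
    ∑ p ∈ adjPairs G, g p.1 ≤ D * ∑ x, g x := by
  classical
  exact sum_comp_le_mul_sum hg (fun _ _ => Finset.mem_univ _)
    fun y => (card_adjPairs_fst_eq G y).trans (hD y)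

lemma sum_le_sum_adjPairs_fst {V : Type} [Fintype V] {G : SimpleGraph V}
    (hG : ∀ v, ∃ w, G.Adj v w) {g : V → ℝ} (hg : ∀ x, 0 ≤ g x) :
    ∑ x, g x ≤ ∑ p ∈ adjPairs G, g p.1 := by
  classical
  refine sum_le_sum_comp hg fun y _ => ?_
  obtain ⟨w, hw⟩ := hG y
  exact ⟨(y, w), by simpa using hw, rfl⟩

lemma sum_adjPairs_swap {V : Type} [Fintype V] (G : SimpleGraph V) (g : V × V → ℝ) :
    ∑ p ∈ adjPairs G, g p.swap = ∑ p ∈ adjPairs G, g p :=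
  Finset.sum_nbij' Prod.swap Prod.swap (by simp [G.adj_comm]) (by simp [G.adj_comm])
    (by simp) (by simp) (by simp)

lemma dirichletEnergy_le {V : Type} [Fintype V] {G : SimpleGraph V} {D : ℕ}
    (hD : ∀ v, (G.neighborSet v).ncard ≤ D) (f : V → ℝ) :
    2⁻¹ * dirichletEnergy G f ≤ 2 * D * ∑ x, f x ^ 2 := by
  have h1 := sum_adjPairs_fst_le hD (g := fun x => f x ^ 2) fun _ => sq_nonneg _
  have h2 := sum_adjPairs_swap G fun p => f p.1 ^ 2
  have h3 : dirichletEnergy G f ≤ ∑ p ∈ adjPairs G, (2 * f p.1 ^ 2 + 2 * f p.2 ^ 2) :=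
    Finset.sum_le_sum fun p _ => by nlinarith [sq_nonneg (f p.1 + f p.2)]
  rw [Finset.sum_add_distrib, ← Finset.mul_sum, ← Finset.mul_sum] at h3
  simp only [Prod.fst_swap] at h2
  linarith

lemma spectralGap_le_two_mul {V : Type} [Fintype V] [Nontrivial V] {G : SimpleGraph V} {D : ℕ}
    (hD : ∀ v, (G.neighborSet v).ncard ≤ D) : spectralGap G ≤ 2 * D := by
  obtain ⟨f, hf, h0⟩ := exists_ne_zero_sum_eq_zero (V := V)
  exact le_of_mul_le_mul_right ((spectralGap_mul_le G h0).trans (dirichletEnergy_le hD f))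
    (sum_sq_pos hf)

lemma sq_sub_zero_le (a : ℕ → ℝ) {i m : ℕ} (hi : i ≤ m) :
    (a i - a 0) ^ 2 ≤ m * ∑ j ∈ Finset.range m, (a j - a (j + 1)) ^ 2 := by
  have h1 : (a i - a 0) ^ 2 = (∑ j ∈ Finset.range i, (a j - a (j + 1))) ^ 2 := by
    rw [Finset.sum_range_sub']
    ring
  rw [h1]
  refine (sq_sum_le_card_mul_sum_sq).trans ?_
  rw [Finset.card_range]
  gcongr

lemma sum_linear_sq (m : ℕ) (M a b : ℝ) :
    ∑ i ∈ Finset.range m, ((M - i) * a + i * b) ^ 2 =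
      m * M ^ 2 * a ^ 2 + m * (m - 1) * M * a * (b - a) +
        (m - 1) * m * (2 * m - 1) / 6 * (b - a) ^ 2 := by
  induction m with
  | zero => simp
  | succ n ih =>
    rw [Finset.sum_range_succ, ih]
    push_cast
    ring

lemma le_sum_interpolation_sq {m : ℕ} (hm : 1 ≤ m) (a b : ℝ) :
    m / 4 * a ^ 2 ≤
      ∑ i ∈ Finset.range m, ((1 - (i : ℝ) / m) * a + (i : ℝ) / m * b) ^ 2 := by
  have hm1 : (1 : ℝ) ≤ m := by exact_mod_cast hm
  have hm0 : (m : ℝ) ≠ 0 := by positivity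
  have h : ∑ i ∈ Finset.range m, ((1 - (i : ℝ) / m) * a + (i : ℝ) / m * b) ^ 2 =
      (∑ i ∈ Finset.range m, (((m : ℝ) - i) * a + i * b) ^ 2) / (m : ℝ) ^ 2 := by
    rw [Finset.sum_div]
    refine Finset.sum_congr rfl fun i _ => ?_
    field_simp
  rw [h, le_div_iff₀ (by positivity), sum_linear_sq]
  generalize (m : ℝ) = x at *
  have hx : 0 < 2 * x - 1 := by linarith
  refine le_of_mul_le_mul_left ?_ hx
  have key : (2 * x - 1) * (x * x ^ 2 * a ^ 2 + x * (x - 1) * x * a * (b - a) +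
        (x - 1) * x * (2 * x - 1) / 6 * (b - a) ^ 2) =
      x / 6 * ((x - 1) * ((2 * x - 1) * b + (x + 1) * a) ^ 2 + 3 * x ^ 2 * (x + 1) * a ^ 2) := by
    ring
  rw [key]
  have h1 : 0 ≤ x / 6 * ((x - 1) * ((2 * x - 1) * b + (x + 1) * a) ^ 2) :=
    mul_nonneg (by linarith) (mul_nonneg (by linarith) (sq_nonneg _))
  have h2 : 0 ≤ x ^ 3 * a ^ 2 := by positivity
  nlinarith

namespace IsMSubdivision

variable {Vz Vy : Type} {Z : SimpleGraph Vz} {Y : SimpleGraph Vy} {m : ℕ} {ι : Vz → Vy}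
  {P : Vz → Vz → ℕ → Vy}

lemma eq_cases (h : IsMSubdivision Z Y m ι P) {u v u' v' : Vz} (huv : Z.Adj u v)
    (huv' : Z.Adj u' v') {i j : ℕ} (hi : i < m) (hj : j < m) (he : P u v i = P u' v' j) :
    (i = 0 ∧ j = 0 ∧ u = u') ∨ (u = u' ∧ v = v' ∧ i = j) ∨
      (u = v' ∧ v = u' ∧ i = m - j ∧ 0 < j ∧ 0 < i) := by
  rcases Nat.eq_zero_or_pos i with rfl | hi0 <;> rcases Nat.eq_zero_or_pos j with rfl | hj0
  · rw [h.start huv, h.start huv'] at he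
    exact Or.inl ⟨rfl, rfl, h.inj he⟩
  · rw [h.start huv] at he
    exact absurd he.symm (h.interior_not_vertex huv' j hj0 hj u)
  · rw [h.start huv'] at he
    exact absurd he (h.interior_not_vertex huv i hi0 hi u')
  · rcases h.interior_disjoint huv huv' i j hi0 hi hj0 hj he with h | ⟨h1, h2, h3⟩
    · exact Or.inr (Or.inl h)
    · exact Or.inr (Or.inr ⟨h1, h2, h3, hj0, hi0⟩)

lemma exists_path_eq (h : IsMSubdivision Z Y m ι P) (hm : 1 ≤ m) (hZ : ∀ v, ∃ w, Z.Adj v w)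
    (y : Vy) : ∃ u v i, Z.Adj u v ∧ i < m ∧ P u v i = y := by
  rcases h.cover y with ⟨x, rfl⟩ | ⟨u, v, i, huv, -, hi, rfl⟩
  · obtain ⟨w, hw⟩ := hZ x
    exact ⟨x, w, 0, hw, hm, h.start hw⟩
  · exact ⟨u, v, i, huv, hi, rfl⟩

/-- A function on the vertices of `Z` extends to `Y`, linearly along every subdivided edge. -/
lemma exists_interpolation (h : IsMSubdivision Z Y m ι P) (hm : 1 ≤ m)
    (hZ : ∀ v, ∃ w, Z.Adj v w) (f : Vz → ℝ) :
    ∃ F : Vy → ℝ, ∀ u v, Z.Adj u v → ∀ i ≤ m,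
      F (P u v i) = (1 - (i : ℝ) / m) * f u + (i : ℝ) / m * f v := by
  have hm0 : (m : ℝ) ≠ 0 := by positivity
  choose U V I hUV hI hP using h.exists_path_eq hm hZ
  set F : Vy → ℝ := fun y => (1 - (I y : ℝ) / m) * f (U y) + (I y : ℝ) / m * f (V y) with hF
  have main : ∀ u v, Z.Adj u v → ∀ i < m,
      F (P u v i) = (1 - (i : ℝ) / m) * f u + (i : ℝ) / m * f v := by
    intro u v huv i hi
    simp only [hF]
    rcases h.eq_cases (hUV _) huv (hI _) hi (hP (P u v i)) with
      ⟨h1, h2, h3⟩ | ⟨h1, h2, h3⟩ | ⟨h1, h2, h3, -⟩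
    · rw [h1, h3, h2]
      simp
    · rw [h1, h2, h3]
    · rw [h1, h2, h3, Nat.cast_sub hi.le]
      field_simp
      ring
  refine ⟨F, fun u v huv i hi => ?_⟩
  rcases hi.lt_or_eq with hi | rfl
  · exact main u v huv i hi
  · rw [h.finish huv, ← h.start huv.symm, main v u huv.symm 0 hm]
    simp [hm0]

variable [Fintype Vz]

lemma card_fiber_le [DecidableEq Vy] (h : IsMSubdivision Z Y m ι P) {D : ℕ} (hD1 : 1 ≤ D)
    (hD : ∀ v, (Z.neighborSet v).ncard ≤ D) (y : Vy) :
    ((adjPairs Z ×ˢ Finset.range m).filter fun t => P t.1.1 t.1.2 t.2 = y).card ≤ D + 1 := by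
  classical
  rcases Finset.eq_empty_or_nonempty
    ((adjPairs Z ×ˢ Finset.range m).filter fun t => P t.1.1 t.1.2 t.2 = y) with he | ⟨t₀, ht₀⟩
  · simp [he]
  obtain ⟨⟨u, v⟩, i⟩ := t₀
  simp only [Finset.mem_filter, Finset.mem_product, mem_adjPairs, Finset.mem_range] at ht₀
  obtain ⟨⟨huv, hi⟩, rfl⟩ := ht₀
  rcases Nat.eq_zero_or_pos i with rfl | hi0
  · calc _ ≤ (((adjPairs Z).filter fun p => p.1 = u) ×ˢ {0}).card := by
          refine Finset.card_le_card ?_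
          rintro ⟨⟨u', v'⟩, j⟩ ht
          simp only [Finset.mem_filter, Finset.mem_product, mem_adjPairs, Finset.mem_range,
            Finset.mem_singleton] at ht ⊢
          obtain ⟨⟨huv', hj⟩, he⟩ := ht
          rcases h.eq_cases huv' huv hj hi he with h1 | h1 | h1
          · exact ⟨⟨huv', h1.2.2⟩, h1.1⟩
          · exact ⟨⟨huv', h1.1⟩, h1.2.2⟩
          · omega
      _ ≤ D + 1 := by
          rw [Finset.card_product, Finset.card_singleton, mul_one]
          exact ((card_adjPairs_fst_eq Z u).trans (hD u)).trans (Nat.le_succ D)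
  · calc _ ≤ ({((u, v), i), ((v, u), m - i)} : Finset ((Vz × Vz) × ℕ)).card := by
          refine Finset.card_le_card ?_
          rintro ⟨⟨u', v'⟩, j⟩ ht
          simp only [Finset.mem_filter, Finset.mem_product, mem_adjPairs, Finset.mem_range,
            Finset.mem_insert, Finset.mem_singleton, Prod.mk.injEq] at ht ⊢
          obtain ⟨⟨huv', hj⟩, he⟩ := ht
          rcases h.eq_cases huv' huv hj hi he with h1 | h1 | h1
          · omega
          · exact Or.inl ⟨⟨h1.1, h1.2.1⟩, h1.2.2⟩
          · exact Or.inr ⟨⟨h1.1, h1.2.1⟩, h1.2.2.1⟩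
      _ ≤ D + 1 := Finset.card_le_two.trans (by omega)

variable [Fintype Vy]

lemma sum_path_le (h : IsMSubdivision Z Y m ι P) {D : ℕ} (hD1 : 1 ≤ D)
    (hD : ∀ v, (Z.neighborSet v).ncard ≤ D) {g : Vy → ℝ} (hg : ∀ y, 0 ≤ g y) :
    ∑ p ∈ adjPairs Z, ∑ i ∈ Finset.range m, g (P p.1 p.2 i) ≤ (D + 1) * ∑ y, g y := by
  classical
  rw [← Finset.sum_product' (f := fun (p : Vz × Vz) i => g (P p.1 p.2 i))]
  have := sum_comp_le_mul_sum (p := fun t : (Vz × Vz) × ℕ => P t.1.1 t.1.2 t.2) hg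
    (fun _ _ => Finset.mem_univ _) (h.card_fiber_le hD1 hD)
  exact_mod_cast this

lemma sum_le_sum_path (h : IsMSubdivision Z Y m ι P) (hm : 1 ≤ m) (hZ : ∀ v, ∃ w, Z.Adj v w)
    {g : Vy → ℝ} (hg : ∀ y, 0 ≤ g y) :
    ∑ y, g y ≤ ∑ p ∈ adjPairs Z, ∑ i ∈ Finset.range m, g (P p.1 p.2 i) := by
  classical
  rw [← Finset.sum_product' (f := fun (p : Vz × Vz) i => g (P p.1 p.2 i))]
  refine sum_le_sum_comp (p := fun t : (Vz × Vz) × ℕ => P t.1.1 t.1.2 t.2) hg fun y _ => ?_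
  obtain ⟨u, v, i, huv, hi, rfl⟩ := h.exists_path_eq hm hZ y
  exact ⟨((u, v), i), by simp [huv, hi], rfl⟩

lemma sum_path_sub_sq_le (h : IsMSubdivision Z Y m ι P) {D : ℕ} (hD1 : 1 ≤ D)
    (hD : ∀ v, (Z.neighborSet v).ncard ≤ D) (g : Vy → ℝ) :
    ∑ p ∈ adjPairs Z, ∑ i ∈ Finset.range m, (g (P p.1 p.2 i) - g (P p.1 p.2 (i + 1))) ^ 2 ≤
      (D + 1) * dirichletEnergy Y g := by
  classical
  rw [← Finset.sum_product'
    (f := fun (p : Vz × Vz) i => (g (P p.1 p.2 i) - g (P p.1 p.2 (i + 1))) ^ 2)]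
  have := sum_comp_le_mul_sum (T := adjPairs Z ×ˢ Finset.range m) (S := adjPairs Y) (k := D + 1)
    (p := fun t : (Vz × Vz) × ℕ => (P t.1.1 t.1.2 t.2, P t.1.1 t.1.2 (t.2 + 1)))
    (g := fun q => (g q.1 - g q.2) ^ 2) (fun _ => sq_nonneg _) ?_ fun q => ?_
  · exact_mod_cast this
  · rintro ⟨⟨u, v⟩, i⟩ ht
    simp only [Finset.mem_product, mem_adjPairs, Finset.mem_range] at ht ⊢
    exact (h.adj_iff _ _).2 ⟨u, v, i, ht.1, ht.2, Or.inl ⟨rfl, rfl⟩⟩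
  · refine le_trans (Finset.card_le_card ?_) (h.card_fiber_le hD1 hD q.1)
    exact Finset.monotone_filter_right _ fun t _ ht => congrArg Prod.fst ht

lemma dirichletEnergy_le_sum_path (h : IsMSubdivision Z Y m ι P) (g : Vy → ℝ) :
    dirichletEnergy Y g ≤
      ∑ p ∈ adjPairs Z, ∑ i ∈ Finset.range m,
        (g (P p.1 p.2 i) - g (P p.1 p.2 (i + 1))) ^ 2 := by
  classical
  rw [← Finset.sum_product'
    (f := fun (p : Vz × Vz) i => (g (P p.1 p.2 i) - g (P p.1 p.2 (i + 1))) ^ 2)]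
  refine sum_le_sum_comp (p := fun t : (Vz × Vz) × ℕ =>
    (P t.1.1 t.1.2 t.2, P t.1.1 t.1.2 (t.2 + 1))) (g := fun q => (g q.1 - g q.2) ^ 2)
    (fun _ => sq_nonneg _) ?_
  rintro ⟨a, b⟩ hab
  rw [mem_adjPairs, h.adj_iff] at hab
  obtain ⟨u, v, i, huv, hi, ⟨ha, hb⟩ | ⟨hb, ha⟩⟩ := hab
  · exact ⟨((u, v), i), by simp [huv, hi], Prod.ext ha.symm hb.symm⟩
  · refine ⟨((v, u), m - (i + 1)), by simp [huv.symm]; omega, ?_⟩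
    have h1 := h.rev huv (i + 1) hi
    have h2 := h.rev huv i hi.le
    have h3 : m - (i + 1) + 1 = m - i := by omega
    simp only at ha hb
    simp only [h3, h1, h2, ha, hb]

lemma dirichletEnergy_comp_le (h : IsMSubdivision Z Y m ι P) {D : ℕ} (hD1 : 1 ≤ D)
    (hD : ∀ v, (Z.neighborSet v).ncard ≤ D) (g : Vy → ℝ) :
    dirichletEnergy Z (fun x => g (ι x)) ≤ m * ((D + 1) * dirichletEnergy Y g) := by
  refine le_trans ?_ (mul_le_mul_of_nonneg_left (h.sum_path_sub_sq_le hD1 hD g) m.cast_nonneg)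
  rw [Finset.mul_sum]
  refine Finset.sum_le_sum fun p hp => ?_
  rw [mem_adjPairs] at hp
  have := sq_sub_zero_le (fun i => g (P p.1 p.2 i)) le_rfl (m := m)
  simp only [h.start hp, h.finish hp] at this
  rwa [sub_sq_comm]

lemma sum_sub_const_sq_le (h : IsMSubdivision Z Y m ι P) (hm : 1 ≤ m)
    (hZ : ∀ v, ∃ w, Z.Adj v w) {D : ℕ} (hD1 : 1 ≤ D)
    (hD : ∀ v, (Z.neighborSet v).ncard ≤ D) (g : Vy → ℝ) (c : ℝ) :
    ∑ y, (g y - c) ^ 2 ≤ 2 * m * D * ∑ x, (g (ι x) - c) ^ 2 +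
      2 * m ^ 2 * ((D + 1) * dirichletEnergy Y g) := by
  have h1 := h.sum_le_sum_path hm hZ (g := fun y => (g y - c) ^ 2) fun _ => sq_nonneg _
  have h2 : ∑ p ∈ adjPairs Z, ∑ i ∈ Finset.range m, (g (P p.1 p.2 i) - c) ^ 2 ≤
      ∑ p ∈ adjPairs Z, (2 * m * (g (ι p.1) - c) ^ 2 + 2 * m ^ 2 * ∑ i ∈ Finset.range m,
        (g (P p.1 p.2 i) - g (P p.1 p.2 (i + 1))) ^ 2) := by
    refine Finset.sum_le_sum fun p hp => ?_
    rw [mem_adjPairs] at hp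
    have : ∀ i ∈ Finset.range m, (g (P p.1 p.2 i) - c) ^ 2 ≤ 2 * (g (ι p.1) - c) ^ 2 +
        2 * (m * ∑ i ∈ Finset.range m, (g (P p.1 p.2 i) - g (P p.1 p.2 (i + 1))) ^ 2) := by
      intro i hi
      have := sq_sub_zero_le (fun i => g (P p.1 p.2 i)) (Finset.mem_range.mp hi).le
      simp only [h.start hp] at this
      nlinarith [sq_nonneg ((g (P p.1 p.2 i) - g (ι p.1)) - (g (ι p.1) - c))]
    refine (Finset.sum_le_sum this).trans_eq ?_
    rw [Finset.sum_const, Finset.card_range, nsmul_eq_mul]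
    ring
  rw [Finset.sum_add_distrib, ← Finset.mul_sum, ← Finset.mul_sum] at h2
  have h3 := sum_adjPairs_fst_le hD (g := fun x => (g (ι x) - c) ^ 2) fun _ => sq_nonneg _
  calc _ ≤ _ := h1.trans h2
    _ ≤ 2 * m * (D * ∑ x, (g (ι x) - c) ^ 2) + 2 * m ^ 2 * ((D + 1) * dirichletEnergy Y g) := by
      gcongr
      exact h.sum_path_sub_sq_le hD1 hD g
    _ = _ := by ring

lemma spectralGap_le_mul [Nontrivial Vz] [Nontrivial Vy] (h : IsMSubdivision Z Y m ι P)
    (hm : 1 ≤ m) (hZ : ∀ v, ∃ w, Z.Adj v w) {D : ℕ} (hD1 : 1 ≤ D)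
    (hD : ∀ v, (Z.neighborSet v).ncard ≤ D) :
    spectralGap Z ≤ 10 * D * (D + 1) * m ^ 2 * spectralGap Y := by
  have hm0 : (0 : ℝ) < m := by exact_mod_cast hm
  have hD0 : (0 : ℝ) < D := by exact_mod_cast hD1
  rw [← div_le_iff₀' (by positivity)]
  refine le_spectralGap fun g _ hg0 => ?_
  rw [div_mul_eq_mul_div, div_le_iff₀ (by positivity)]
  set c : ℝ := (∑ x, g (ι x)) / Fintype.card Vz
  set E := dirichletEnergy Y g
  have hE : 0 ≤ E := dirichletEnergy_nonneg _ _
  have h1 := sum_sq_le_sum_sub_const_sq hg0 c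
  have h2 := h.sum_sub_const_sq_le hm hZ hD1 hD g c
  have h3 := spectralGap_mul_le Z (sum_sub_mean fun x => g (ι x))
  rw [dirichletEnergy_sub_const] at h3
  have h4 := h.dirichletEnergy_comp_le hD1 hD g
  have h5 := spectralGap_le_two_mul hD
  have h6 := spectralGap_nonneg Z
  calc spectralGap Z * ∑ y, g y ^ 2
      ≤ spectralGap Z * (2 * m * D * ∑ x, (g (ι x) - c) ^ 2 + 2 * m ^ 2 * ((D + 1) * E)) :=
        mul_le_mul_of_nonneg_left (h1.trans h2) h6
    _ = 2 * m * D * (spectralGap Z * ∑ x, (g (ι x) - c) ^ 2) +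
        spectralGap Z * (2 * m ^ 2 * ((D + 1) * E)) := by ring
    _ ≤ 2 * m * D * (2⁻¹ * (m * ((D + 1) * E))) + 2 * D * (2 * m ^ 2 * ((D + 1) * E)) := by
        refine add_le_add (mul_le_mul_of_nonneg_left (h3.trans ?_) (by positivity)) ?_ <;> gcongr
    _ = _ := by ring

lemma mul_spectralGap_le [Nontrivial Vz] [Nontrivial Vy] (h : IsMSubdivision Z Y m ι P)
    (hm : 1 ≤ m) (hZ : ∀ v, ∃ w, Z.Adj v w) {D : ℕ} (hD1 : 1 ≤ D)
    (hD : ∀ v, (Z.neighborSet v).ncard ≤ D) :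
    m ^ 2 * spectralGap Y ≤ 4 * (D + 1) * spectralGap Z := by
  have hm0 : (0 : ℝ) < m := by exact_mod_cast hm
  rw [← div_le_iff₀' (by positivity)]
  refine le_spectralGap fun f _ hf0 => ?_
  rw [div_mul_eq_mul_div, div_le_iff₀ (by positivity)]
  obtain ⟨F, hF⟩ := h.exists_interpolation hm hZ f
  set c : ℝ := (∑ y, F y) / Fintype.card Vy
  have h1 := spectralGap_mul_le Y (sum_sub_mean F)
  rw [dirichletEnergy_sub_const] at h1
  have h2 : m * dirichletEnergy Y F ≤ dirichletEnergy Z f := by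
    refine (mul_le_mul_of_nonneg_left (h.dirichletEnergy_le_sum_path F) hm0.le).trans_eq ?_
    rw [Finset.mul_sum]
    refine Finset.sum_congr rfl fun p hp => ?_
    rw [mem_adjPairs] at hp
    have : ∀ i ∈ Finset.range m, (F (P p.1 p.2 i) - F (P p.1 p.2 (i + 1))) ^ 2 =
        (f p.1 - f p.2) ^ 2 / m ^ 2 := by
      intro i hi
      rw [Finset.mem_range] at hi
      rw [hF _ _ hp i hi.le, hF _ _ hp (i + 1) hi]
      push_cast
      field_simp
      ring
    rw [Finset.sum_congr rfl this, Finset.sum_const, Finset.card_range, nsmul_eq_mul]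
    field_simp
  have h3 : m / 4 * ∑ x, f x ^ 2 ≤ (D + 1) * ∑ y, (F y - c) ^ 2 := by
    calc m / 4 * ∑ x, f x ^ 2 ≤ m / 4 * ∑ p ∈ adjPairs Z, (f p.1 - c) ^ 2 := by
          gcongr
          exact (sum_sq_le_sum_sub_const_sq hf0 c).trans
            (sum_le_sum_adjPairs_fst hZ (g := fun x => (f x - c) ^ 2) fun _ => sq_nonneg _)
      _ ≤ ∑ p ∈ adjPairs Z, ∑ i ∈ Finset.range m, (F (P p.1 p.2 i) - c) ^ 2 := by
          rw [Finset.mul_sum]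
          refine Finset.sum_le_sum fun p hp => ?_
          rw [mem_adjPairs] at hp
          refine (le_sum_interpolation_sq hm (f p.1 - c) (f p.2 - c)).trans_eq ?_
          refine Finset.sum_congr rfl fun i hi => ?_
          rw [hF _ _ hp i (Finset.mem_range.mp hi).le]
          ring
      _ ≤ _ := h.sum_path_le hD1 hD (g := fun y => (F y - c) ^ 2) fun _ => sq_nonneg _
  have h4 := spectralGap_nonneg Y
  calc m ^ 2 * spectralGap Y * ∑ x, f x ^ 2
      = 4 * m * spectralGap Y * (m / 4 * ∑ x, f x ^ 2) := by ring
    _ ≤ 4 * m * spectralGap Y * ((D + 1) * ∑ y, (F y - c) ^ 2) := by gcongr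
    _ = 4 * (D + 1) * m * (spectralGap Y * ∑ y, (F y - c) ^ 2) := by ring
    _ ≤ 4 * (D + 1) * m * (2⁻¹ * dirichletEnergy Y F) := by gcongr
    _ = 4 * (D + 1) * 2⁻¹ * (m * dirichletEnergy Y F) := by ring
    _ ≤ 4 * (D + 1) * 2⁻¹ * dirichletEnergy Z f := by gcongr
    _ = _ := by ring

end IsMSubdivision

/-- For every degree bound `D ≥ 1` there is `C > 0` such that for every finite connected
simple graph `Z` with at least one edge and maximum degree at most `D`, and every `m ≥ 1`,
the `m`-fold subdivision `Z⁽ᵐ⁾` satisfies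
`(1/C)·λ₁(Z)/m² ≤ λ₁(Z⁽ᵐ⁾) ≤ C·λ₁(Z)/m²`. -/
theorem spectralGap_subdivision :
    ∀ D : ℕ, 1 ≤ D → ∃ C : ℝ, 0 < C ∧
      ∀ (Vz Vy : Type) [Fintype Vz] [Fintype Vy]
        (Z : SimpleGraph Vz) (Y : SimpleGraph Vy) (m : ℕ)
        (ι : Vz → Vy) (P : Vz → Vz → ℕ → Vy),
        1 ≤ m → Z.Connected → Z.edgeSet.Nonempty →
        (∀ v : Vz, (Z.neighborSet v).ncard ≤ D) →
        IsMSubdivision Z Y m ι P →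
        (1 / C) * (spectralGap Z / (m : ℝ) ^ 2) ≤ spectralGap Y ∧
          spectralGap Y ≤ C * (spectralGap Z / (m : ℝ) ^ 2) := by
  intro D hD1
  have hD0 : (1 : ℝ) ≤ D := by exact_mod_cast hD1
  refine ⟨10 * D * (D + 1), by positivity, ?_⟩
  intro Vz Vy _ _ Z Y m ι P hm hconn hne hD h
  have hm0 : (0 : ℝ) < m := by exact_mod_cast hm
  obtain ⟨a, b, hab⟩ : ∃ a b, Z.Adj a b := by
    obtain ⟨⟨a, b⟩, he⟩ := hne
    exact ⟨a, b, he⟩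
  have : Nontrivial Vz := ⟨a, b, hab.ne⟩
  have : Nontrivial Vy := h.inj.nontrivial
  have hZ := hconn.preconnected.exists_adj_of_nontrivial
  have h1 := h.spectralGap_le_mul hm hZ hD1 hD
  have h2 := h.mul_spectralGap_le hm hZ hD1 hD
  constructor
  · rw [one_div_mul_eq_div, div_div, div_le_iff₀ (by positivity)]
    linarith
  · rw [← mul_div_assoc, le_div_iff₀ (by positivity), mul_comm]
    refine h2.trans (mul_le_mul_of_nonneg_right ?_ (spectralGap_nonneg Z))
    nlinarith
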